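/- Restart comparison: let c be a speed function, v₀ nondecreasing and 1-Lipschitz, t > 0 and 0 < h < t. Define v(y,s) := sup_{q∈ℝ} { v₀(q) − g^q(y−q, s) }, and the restarted value v̄(x,h) := sup_{q∈ℝ} { v(q, t−h) − ḡ^q(x−q, h) }, where ḡ^q(r,h) := inf{ y ≥ β(r) : Γ̃_c( (q, −v(q,t−h)), (q+r, y − v(q,t−h)) ) ≥ h } with Γ̃_c((x₁,y₁),(x₂,y₂)) := Γ_c((x₁+y₁,y₁),(x₂+y₂,y₂)). Assume the suprema defining v̄(x,h) and the corresponding v(q,t−h) are attained and that all superlevel sets appearing in the definitions of the level curves are nonempty and closed (as holds under the paper's assumptions). Then v̄(x,h) ≤ v(x,t). -/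

import Mathlib

open MeasureTheory

/-- `ψ(y)`: the negative Legendre dual of the TASEP flux, given piecewise. -/
noncomputable def psi (y : ℝ) : ℝ :=
  if y < -1 then -y else if y ≤ 1 then (1 - y) ^ 2 / 4 else 0

/-- The homogeneous exponential last-passage shape function `γ(x,y) = (√x + √y)²`. -/
noncomputable def gam (x y : ℝ) : ℝ := (Real.sqrt x + Real.sqrt y) ^ 2

/-- The lower wedge boundary `β(x) = max(0, −x)`. -/
def beta (x : ℝ) : ℝ := max 0 (-x)

/-- A speed function: Borel measurable, strictly positive, and on every compact set
bounded above and bounded below away from `0`. -/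
def SpeedFunction (c : ℝ × ℝ → ℝ) : Prop :=
  Measurable c ∧ (∀ z, 0 < c z) ∧
    ∀ K : Set (ℝ × ℝ), IsCompact K →
      ∃ m M : ℝ, 0 < m ∧ ∀ z ∈ K, m ≤ c z ∧ c z ≤ M

/-- An admissible macroscopic path from `A` to `B`: continuous on `[0,1]`, piecewise `C¹`
(differentiable off a finite set), with nonnegative derivative components. -/
structure AdmissiblePath (A B : ℝ × ℝ) where
  p : ℝ → ℝ × ℝ
  cont : ContinuousOn p (Set.Icc 0 1)
  init : p 0 = A
  ep : p 1 = B
  pw : ∃ T : Finset ℝ, ∀ s ∈ Set.Ioo (0 : ℝ) 1, s ∉ T →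
    DifferentiableAt ℝ p s ∧ 0 ≤ (deriv p s).1 ∧ 0 ≤ (deriv p s).2

/-- The weight `∫₀¹ γ(x₁′(s), x₂′(s)) / c(x(s)) ds` collected by a path. -/
noncomputable def pathWeight (c : ℝ × ℝ → ℝ) (p : ℝ → ℝ × ℝ) : ℝ :=
  ∫ s in (0 : ℝ)..1, gam (deriv p s).1 (deriv p s).2 / c (p s)

/-- The macroscopic two-point last-passage value `Γ_c(A,B)`, a supremum over admissible
paths from `A` to `B`. -/
noncomputable def Gamma (c : ℝ × ℝ → ℝ) (A B : ℝ × ℝ) : ℝ :=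
  sSup { w : ℝ | ∃ P : AdmissiblePath A B, w = pathWeight c P.p }

/-- The `q`-shifted shape function
`Γ_c^q(x,y) = Γ_c((q − v₀(q), −v₀(q)), (x + q − v₀(q), y − v₀(q)))`. -/
noncomputable def GammaQ (c : ℝ × ℝ → ℝ) (v₀ : ℝ → ℝ) (q x y : ℝ) : ℝ :=
  Gamma c (q - v₀ q, -v₀ q) (x + q - v₀ q, y - v₀ q)

/-- The level curve `g^q(x,t) = inf{ y ≥ β(x) : Γ_c^q(x+y, y) ≥ t }`. -/
noncomputable def levelCurve (c : ℝ × ℝ → ℝ) (v₀ : ℝ → ℝ) (q x t : ℝ) : ℝ :=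
  sInf { y : ℝ | beta x ≤ y ∧ t ≤ GammaQ c v₀ q (x + y) y }

/-- The wedge last-passage value `Γ̃_c((x₁,y₁),(x₂,y₂)) = Γ_c((x₁+y₁,y₁),(x₂+y₂,y₂))`. -/
noncomputable def GammaW (c : ℝ × ℝ → ℝ) (P Q : ℝ × ℝ) : ℝ :=
  Gamma c (P.1 + P.2, P.2) (Q.1 + Q.2, Q.2)

/-- The hydrodynamic limit `v(y,s) = sup_q { v₀(q) − g^q(y−q,s) }`. -/
noncomputable def hydroV (c : ℝ × ℝ → ℝ) (v₀ : ℝ → ℝ) (y s : ℝ) : ℝ :=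
  ⨆ q : ℝ, (v₀ q - levelCurve c v₀ q (y - q) s)

/-- The restarted level curve `ḡ^q(r,h)`, rooted at `(q, −v(q,t−h))`. -/
noncomputable def gbar (c : ℝ × ℝ → ℝ) (v₀ : ℝ → ℝ) (t h q r : ℝ) : ℝ :=
  sInf {y : ℝ | beta r ≤ y ∧
    h ≤ GammaW c (q, -(hydroV c v₀ q (t - h)))
      (q + r, y - hydroV c v₀ q (t - h))}

/-- The restarted current `v̄(x,h) = sup_q { v(q,t−h) − ḡ^q(x−q,h) }`. -/
noncomputable def vbar (c : ℝ × ℝ → ℝ) (v₀ : ℝ → ℝ) (t h x : ℝ) : ℝ :=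
  ⨆ q : ℝ, (hydroV c v₀ q (t - h) - gbar c v₀ t h q (x - q))

theorem aux_mono (f : ℝ → ℝ) (T : Finset ℝ) : ∀ a b : ℝ, a ≤ b → ContinuousOn f (Set.Icc a b) →
    (∀ s ∈ Set.Ioo a b, s ∉ T → DifferentiableAt ℝ f s ∧ 0 ≤ deriv f s) → f a ≤ f b := by
  induction T using Finset.induction_on with
  | empty =>
    intro a b hab hc hd
    refine monotoneOn_of_deriv_nonneg (convex_Icc a b) hc ?_ ?_ ⟨le_refl _, hab⟩ ⟨hab, le_refl _⟩ hab
    · rw [interior_Icc]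
      intro s hs
      exact (hd s hs (by simp)).1.differentiableWithinAt
    · rw [interior_Icc]
      intro s hs
      exact (hd s hs (by simp)).2
  | insert τ T' _ ih =>
    intro a b hab hc hd
    by_cases hτ : τ ∈ Set.Ioo a b
    · have h1 := ih a τ hτ.1.le (hc.mono (Set.Icc_subset_Icc le_rfl hτ.2.le)) (by
        intro s hs hsT
        refine hd s ⟨hs.1, hs.2.trans hτ.2⟩ ?_
        simp only [Finset.mem_insert, not_or]
        exact ⟨hs.2.ne, hsT⟩)
      have h2 := ih τ b hτ.2.le (hc.mono (Set.Icc_subset_Icc hτ.1.le le_rfl)) (by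
        intro s hs hsT
        refine hd s ⟨hτ.1.trans hs.1, hs.2⟩ ?_
        simp only [Finset.mem_insert, not_or]
        exact ⟨hs.1.ne', hsT⟩)
      exact h1.trans h2
    · refine ih a b hab hc ?_
      intro s hs hsT
      refine hd s hs ?_
      simp only [Finset.mem_insert, not_or]
      exact ⟨fun h => hτ (h ▸ hs), hsT⟩

theorem aux_monoOn (f : ℝ → ℝ) (T : Finset ℝ) (hc : ContinuousOn f (Set.Icc 0 1))
    (hd : ∀ s ∈ Set.Ioo (0 : ℝ) 1, s ∉ T → DifferentiableAt ℝ f s ∧ 0 ≤ deriv f s) :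
    MonotoneOn f (Set.Icc 0 1) := by
  intro a ha b hb hab
  refine aux_mono f T a b hab (hc.mono (Set.Icc_subset_Icc ha.1 hb.2)) ?_
  intro s hs hsT
  exact hd s ⟨ha.1.trans_lt hs.1, hs.2.trans_le hb.2⟩ hsT

theorem aux_gam (u v : ℝ) (hu : 0 ≤ u) (hv : 0 ≤ v) : gam u v ≤ 2 * (u + v) := by
  unfold gam
  nlinarith [Real.sq_sqrt hu, Real.sq_sqrt hv, sq_nonneg (Real.sqrt u - Real.sqrt v)]

theorem aux_gam_two (u v : ℝ) : gam (2 * u) (2 * v) = 2 * gam u v := by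
  unfold gam
  rw [Real.sqrt_mul (by norm_num), Real.sqrt_mul (by norm_num), ← mul_add, mul_pow,
    Real.sq_sqrt (by norm_num)]

theorem aux_deriv_fst (p : ℝ → ℝ × ℝ) (s : ℝ) (h : DifferentiableAt ℝ p s) :
    HasDerivAt (fun s => (p s).1) (deriv p s).1 s := by
  have := (ContinuousLinearMap.fst ℝ ℝ ℝ).hasFDerivAt.comp_hasDerivAt s h.hasDerivAt
  exact this

theorem aux_deriv_snd (p : ℝ → ℝ × ℝ) (s : ℝ) (h : DifferentiableAt ℝ p s) :
    HasDerivAt (fun s => (p s).2) (deriv p s).2 s := by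
  have := (ContinuousLinearMap.snd ℝ ℝ ℝ).hasFDerivAt.comp_hasDerivAt s h.hasDerivAt
  exact this

theorem aux_path_mono {A B : ℝ × ℝ} (P : AdmissiblePath A B) :
    MonotoneOn P.p (Set.Icc 0 1) := by
  obtain ⟨T, hT⟩ := P.pw
  have h1 := aux_monoOn (fun s => (P.p s).1) T (continuous_fst.comp_continuousOn P.cont) (by
    intro s hs hsT
    obtain ⟨hd, h1, h2⟩ := hT s hs hsT
    have := aux_deriv_fst P.p s hd
    exact ⟨this.differentiableAt, by rw [this.deriv]; exact h1⟩)
  have h2 := aux_monoOn (fun s => (P.p s).2) T (continuous_snd.comp_continuousOn P.cont) (by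
    intro s hs hsT
    obtain ⟨hd, h1, h2⟩ := hT s hs hsT
    have := aux_deriv_snd P.p s hd
    exact ⟨this.differentiableAt, by rw [this.deriv]; exact h2⟩)
  intro a ha b hb hab
  exact ⟨h1 ha hb hab, h2 ha hb hab⟩

theorem aux_path_box {A B : ℝ × ℝ} (P : AdmissiblePath A B) (s : ℝ) (hs : s ∈ Set.Icc (0 : ℝ) 1) :
    P.p s ∈ Set.Icc A B := by
  have hm := aux_path_mono P
  constructor
  · have := hm ⟨le_rfl, zero_le_one⟩ hs hs.1
    rwa [P.init] at this
  · have := hm hs ⟨zero_le_one, le_rfl⟩ hs.2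
    rwa [P.ep] at this

theorem aux_weight {c : ℝ × ℝ → ℝ} (hc : Measurable c) {A B : ℝ × ℝ} (P : AdmissiblePath A B)
    (m : ℝ) (hm : 0 < m) (hmc : ∀ z ∈ Set.Icc A B, m ≤ c z) :
    IntervalIntegrable (fun s => gam (deriv P.p s).1 (deriv P.p s).2 / c (P.p s)) volume 0 1 ∧
    pathWeight c P.p ≤ 2 / m * ((B.1 + B.2) - (A.1 + A.2)) := by
  obtain ⟨T, hT⟩ := P.pw
  have hmon : MonotoneOn (fun s => (P.p s).1 + (P.p s).2) (Set.uIcc 0 1) := by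
    rw [Set.uIcc_of_le zero_le_one]
    intro a ha b hb hab
    have := aux_path_mono P ha hb hab
    exact add_le_add this.1 this.2
  have hint := hmon.intervalIntegrable_deriv
  have hle := hmon.intervalIntegral_deriv_mem_uIcc
  have h01 : (P.p 0).1 + (P.p 0).2 ≤ (P.p 1).1 + (P.p 1).2 :=
    hmon (by simp) (by simp) zero_le_one
  rw [Set.uIcc_of_le (by linarith)] at hle
  have hle2 := hle.2
  rw [P.init, P.ep] at hle2
  have hae : ∀ᵐ s ∂(volume.restrict (Set.Ioc (0 : ℝ) 1)), s ∈ Set.Ioo (0 : ℝ) 1 ∧ s ∉ T := by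
    have hfin : ∀ᵐ s ∂(volume : Measure ℝ), s ∉ ((insert 1 T : Finset ℝ) : Set ℝ) :=
      (Finset.finite_toSet _).countable.ae_notMem volume
    filter_upwards [ae_restrict_mem measurableSet_Ioc, ae_restrict_of_ae hfin] with s hs hs2
    simp only [Finset.coe_insert, Set.mem_insert_iff, Finset.mem_coe, not_or] at hs2
    exact ⟨⟨hs.1, lt_of_le_of_ne hs.2 hs2.1⟩, hs2.2⟩
  have hbd : ∀ᵐ s ∂(volume.restrict (Set.Ioc (0 : ℝ) 1)),
      0 ≤ gam (deriv P.p s).1 (deriv P.p s).2 / c (P.p s) ∧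
      gam (deriv P.p s).1 (deriv P.p s).2 / c (P.p s) ≤
        2 / m * deriv (fun s => (P.p s).1 + (P.p s).2) s := by
    filter_upwards [hae] with s hs
    obtain ⟨hd, h1, h2⟩ := hT s hs.1 hs.2
    have hder : deriv (fun s => (P.p s).1 + (P.p s).2) s = (deriv P.p s).1 + (deriv P.p s).2 :=
      ((aux_deriv_fst P.p s hd).add (aux_deriv_snd P.p s hd)).deriv
    have hcm := hmc _ (aux_path_box P s ⟨hs.1.1.le, hs.1.2.le⟩)
    have hg0 : 0 ≤ gam (deriv P.p s).1 (deriv P.p s).2 := sq_nonneg _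
    refine ⟨div_nonneg hg0 (hm.le.trans hcm), ?_⟩
    rw [hder]
    calc _ ≤ gam (deriv P.p s).1 (deriv P.p s).2 / m :=
          div_le_div_of_nonneg_left hg0 hm hcm
      _ ≤ (2 * ((deriv P.p s).1 + (deriv P.p s).2)) / m :=
          div_le_div_of_nonneg_right (aux_gam _ _ h1 h2) hm.le
      _ = _ := by ring
  have hint2 : IntervalIntegrable (fun s => 2 / m * deriv (fun s => (P.p s).1 + (P.p s).2) s)
      volume 0 1 := hint.const_mul _
  have hmeas : AEStronglyMeasurable (fun s => gam (deriv P.p s).1 (deriv P.p s).2 / c (P.p s))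
      (volume.restrict (Set.Ioc (0 : ℝ) 1)) := by
    have hp : AEMeasurable P.p (volume.restrict (Set.Ioc (0 : ℝ) 1)) :=
      (P.cont.mono Set.Ioc_subset_Icc_self).aemeasurable measurableSet_Ioc
    have hd : Measurable (deriv P.p) := measurable_deriv P.p
    have hg : Measurable (fun s => gam (deriv P.p s).1 (deriv P.p s).2) := by
      unfold gam
      exact ((hd.fst.sqrt).add (hd.snd.sqrt)).pow_const 2
    exact (hg.aemeasurable.div (hc.comp_aemeasurable hp)).aestronglyMeasurable
  have hI : IntervalIntegrable (fun s => gam (deriv P.p s).1 (deriv P.p s).2 / c (P.p s))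
      volume 0 1 := by
    rw [intervalIntegrable_iff_integrableOn_Ioc_of_le zero_le_one] at hint2 ⊢
    refine Integrable.mono' hint2 hmeas ?_
    filter_upwards [hbd] with s hs
    rw [Real.norm_of_nonneg hs.1]
    exact hs.2
  refine ⟨hI, ?_⟩
  have h3 : pathWeight c P.p ≤
      ∫ s in (0 : ℝ)..1, 2 / m * deriv (fun s => (P.p s).1 + (P.p s).2) s := by
    unfold pathWeight
    rw [intervalIntegral.integral_of_le zero_le_one, intervalIntegral.integral_of_le zero_le_one]
    rw [intervalIntegrable_iff_integrableOn_Ioc_of_le zero_le_one] at hint2 hI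
    refine integral_mono_ae hI hint2 ?_
    filter_upwards [hbd] with s hs
    exact hs.2
  rw [intervalIntegral.integral_const_mul] at h3
  exact h3.trans (mul_le_mul_of_nonneg_left hle2 (by positivity))

noncomputable def catFun (f g : ℝ → ℝ × ℝ) (s : ℝ) : ℝ × ℝ :=
  if s ≤ 1 / 2 then f (2 * s) else g (2 * s - 1)

theorem cat_left (f g : ℝ → ℝ × ℝ) (s : ℝ) (hs : s < 1 / 2) :
    catFun f g =ᶠ[nhds s] fun u => f (2 * u) := by
  filter_upwards [Iio_mem_nhds hs] with u hu
  unfold catFun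
  rw [if_pos (le_of_lt hu)]

theorem cat_right (f g : ℝ → ℝ × ℝ) (s : ℝ) (hs : 1 / 2 < s) :
    catFun f g =ᶠ[nhds s] fun u => g (2 * u - 1) := by
  filter_upwards [Ioi_mem_nhds hs] with u hu
  unfold catFun
  rw [if_neg (not_le.mpr hu)]

theorem cat_deriv_left (f g : ℝ → ℝ × ℝ) (s : ℝ) (hs : s < 1 / 2) :
    deriv (catFun f g) s = (2 : ℝ) • deriv f (2 * s) := by
  rw [(cat_left f g s hs).deriv_eq]
  exact deriv_comp_mul_left 2 f s

theorem cat_deriv_right (f g : ℝ → ℝ × ℝ) (s : ℝ) (hs : 1 / 2 < s) :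
    deriv (catFun f g) s = (2 : ℝ) • deriv g (2 * s - 1) := by
  rw [(cat_right f g s hs).deriv_eq]
  have := deriv_comp_mul_left 2 (fun u => g (u - 1)) s
  rw [this, deriv_comp_sub_const]

theorem exists_cat {A B C : ℝ × ℝ} (P : AdmissiblePath A B) (Q : AdmissiblePath B C) :
    ∃ R : AdmissiblePath A C, R.p = catFun P.p Q.p := by
  refine ⟨⟨catFun P.p Q.p, ?_, ?_, ?_, ?_⟩, rfl⟩
  · have h : ContinuousOn (catFun P.p Q.p) (Set.Icc 0 (1 / 2) ∪ Set.Icc (1 / 2) 1) := by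
      refine ContinuousOn.union_of_isClosed ?_ ?_ isClosed_Icc isClosed_Icc
      · have : ContinuousOn (fun u : ℝ => P.p (2 * u)) (Set.Icc 0 (1 / 2)) := by
          refine P.cont.comp (by fun_prop) ?_
          intro u hu
          exact ⟨by linarith [hu.1], by linarith [hu.2]⟩
        refine this.congr ?_
        intro u hu
        unfold catFun
        rw [if_pos hu.2]
      · have : ContinuousOn (fun u : ℝ => Q.p (2 * u - 1)) (Set.Icc (1 / 2) 1) := by
          refine Q.cont.comp (by fun_prop) ?_
          intro u hu
          exact ⟨by linarith [hu.1], by linarith [hu.2]⟩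
        refine this.congr ?_
        intro u hu
        unfold catFun
        by_cases h : u ≤ 1 / 2
        · have hu2 : u = 1 / 2 := le_antisymm h hu.1
          rw [if_pos h, hu2]
          norm_num
          rw [P.ep, Q.init]
        · rw [if_neg h]
    rwa [Set.Icc_union_Icc_eq_Icc (by norm_num) (by norm_num)] at h
  · unfold catFun
    rw [if_pos (by norm_num), mul_zero, P.init]
  · unfold catFun
    rw [if_neg (by norm_num)]
    norm_num
    exact Q.ep
  · obtain ⟨T, hT⟩ := P.pw
    obtain ⟨U, hU⟩ := Q.pw
    classical
    refine ⟨insert (1 / 2) (T.image (fun u => u / 2) ∪ U.image (fun u => (u + 1) / 2)), ?_⟩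
    intro s hs hsn
    simp only [Finset.mem_insert, Finset.mem_union, Finset.mem_image, not_or, not_exists,
      not_and] at hsn
    obtain ⟨hne, hnT, hnU⟩ := hsn
    rcases lt_or_gt_of_ne hne with h | h
    · have hs2 : 2 * s ∈ Set.Ioo (0 : ℝ) 1 := ⟨by linarith [hs.1], by linarith⟩
      obtain ⟨hd, h1, h2⟩ := hT (2 * s) hs2 (fun hmem => hnT _ hmem (by ring))
      rw [cat_deriv_left _ _ _ h]
      refine ⟨?_, ?_, ?_⟩
      · rw [(cat_left P.p Q.p s h).differentiableAt_iff]
        exact DifferentiableAt.comp s (f := fun u : ℝ => 2 * u) hd (by fun_prop)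
      · simpa using h1
      · simpa using h2
    · have hs2 : 2 * s - 1 ∈ Set.Ioo (0 : ℝ) 1 := ⟨by linarith, by linarith [hs.2]⟩
      obtain ⟨hd, h1, h2⟩ := hU (2 * s - 1) hs2 (fun hmem => hnU _ hmem (by ring))
      rw [cat_deriv_right _ _ _ h]
      refine ⟨?_, ?_, ?_⟩
      · rw [(cat_right P.p Q.p s h).differentiableAt_iff]
        exact DifferentiableAt.comp s (f := fun u : ℝ => 2 * u - 1) hd (by fun_prop)
      · simpa using h1
      · simpa using h2

theorem int_left (F : ℝ → ℝ) :
    ∫ s in (0 : ℝ)..(1 / 2), 2 * F (2 * s) = ∫ s in (0 : ℝ)..1, F s := by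
  rw [intervalIntegral.integral_const_mul, intervalIntegral.integral_comp_mul_left F two_ne_zero]
  norm_num
  ring

theorem int_right (F : ℝ → ℝ) :
    ∫ s in (1 / 2 : ℝ)..1, 2 * F (2 * s - 1) = ∫ s in (0 : ℝ)..1, F s := by
  rw [intervalIntegral.integral_const_mul, intervalIntegral.integral_comp_mul_sub F two_ne_zero]
  norm_num
  ring

theorem cat_weight (c : ℝ × ℝ → ℝ) (f g : ℝ → ℝ × ℝ)
    (hI : IntervalIntegrable (fun s => gam (deriv (catFun f g) s).1 (deriv (catFun f g) s).2 /
      c (catFun f g s)) volume 0 1) :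
    pathWeight c (catFun f g) = pathWeight c f + pathWeight c g := by
  unfold pathWeight
  have ha : IntervalIntegrable (fun s => gam (deriv (catFun f g) s).1 (deriv (catFun f g) s).2 /
      c (catFun f g s)) volume 0 (1 / 2) := by
    refine hI.mono_set ?_
    rw [Set.uIcc_of_le (by norm_num), Set.uIcc_of_le (by norm_num)]
    exact Set.Icc_subset_Icc le_rfl (by norm_num)
  have hb : IntervalIntegrable (fun s => gam (deriv (catFun f g) s).1 (deriv (catFun f g) s).2 /
      c (catFun f g s)) volume (1 / 2) 1 := by
    refine hI.mono_set ?_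
    rw [Set.uIcc_of_le (by norm_num), Set.uIcc_of_le (by norm_num)]
    exact Set.Icc_subset_Icc (by norm_num) le_rfl
  rw [← intervalIntegral.integral_add_adjacent_intervals ha hb]
  congr 1
  · have : ∫ s in (0 : ℝ)..(1 / 2), gam (deriv (catFun f g) s).1 (deriv (catFun f g) s).2 /
        c (catFun f g s) = ∫ s in (0 : ℝ)..(1 / 2),
        2 * (fun u => gam (deriv f u).1 (deriv f u).2 / c (f u)) (2 * s) := by
      refine intervalIntegral.integral_congr_ae ?_
      have hne : ∀ᵐ s ∂(volume : Measure ℝ), s ≠ 1 / 2 := by simp [ae_iff]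
      filter_upwards [hne] with s hs hmem
      rw [Set.uIoc_of_le (by norm_num)] at hmem
      have hlt : s < 1 / 2 := lt_of_le_of_ne hmem.2 hs
      rw [cat_deriv_left _ _ _ hlt, (cat_left f g s hlt).eq_of_nhds]
      simp only [Prod.smul_fst, Prod.smul_snd, smul_eq_mul, aux_gam_two]
      ring
    rw [this]
    exact int_left (fun u => gam (deriv f u).1 (deriv f u).2 / c (f u))
  · have : ∫ s in (1 / 2 : ℝ)..1, gam (deriv (catFun f g) s).1 (deriv (catFun f g) s).2 /
        c (catFun f g s) = ∫ s in (1 / 2 : ℝ)..1,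
        2 * (fun u => gam (deriv g u).1 (deriv g u).2 / c (g u)) (2 * s - 1) := by
      refine intervalIntegral.integral_congr_ae ?_
      refine Filter.Eventually.of_forall ?_
      intro s hmem
      rw [Set.uIoc_of_le (by norm_num)] at hmem
      rw [cat_deriv_right _ _ _ hmem.1, (cat_right f g s hmem.1).eq_of_nhds]
      simp only [Prod.smul_fst, Prod.smul_snd, smul_eq_mul, aux_gam_two]
      ring
    rw [this]
    exact int_right (fun u => gam (deriv g u).1 (deriv g u).2 / c (g u))

theorem Gamma_superadd {c : ℝ × ℝ → ℝ} (hc : SpeedFunction c) {A B C : ℝ × ℝ}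
    (h1 : 0 < Gamma c A B) (h2 : 0 < Gamma c B C) :
    Gamma c A B + Gamma c B C ≤ Gamma c A C := by
  obtain ⟨hcm, -, hK⟩ := hc
  obtain ⟨m, M, hm, hmc⟩ := hK (Set.Icc A C) isCompact_Icc
  have hmc' : ∀ z ∈ Set.Icc A C, m ≤ c z := fun z hz => (hmc z hz).1
  have hbdd : BddAbove {w : ℝ | ∃ P : AdmissiblePath A C, w = pathWeight c P.p} := by
    refine ⟨2 / m * ((C.1 + C.2) - (A.1 + A.2)), ?_⟩
    rintro w ⟨P, rfl⟩
    exact (aux_weight hcm P m hm hmc').2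
  have hne1 : {w : ℝ | ∃ P : AdmissiblePath A B, w = pathWeight c P.p}.Nonempty := by
    by_contra hcon
    rw [Set.not_nonempty_iff_eq_empty] at hcon
    unfold Gamma at h1
    rw [hcon, Real.sSup_empty] at h1
    exact lt_irrefl _ h1
  have hne2 : {w : ℝ | ∃ P : AdmissiblePath B C, w = pathWeight c P.p}.Nonempty := by
    by_contra hcon
    rw [Set.not_nonempty_iff_eq_empty] at hcon
    unfold Gamma at h2
    rw [hcon, Real.sSup_empty] at h2
    exact lt_irrefl _ h2
  have key : ∀ (P : AdmissiblePath A B) (Q : AdmissiblePath B C),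
      pathWeight c P.p + pathWeight c Q.p ≤ Gamma c A C := by
    intro P Q
    obtain ⟨R, hR⟩ := exists_cat P Q
    have hI := (aux_weight hcm R m hm hmc').1
    rw [hR] at hI
    rw [← cat_weight c P.p Q.p hI, ← hR]
    exact le_csSup hbdd ⟨R, rfl⟩
  have : Gamma c A B ≤ Gamma c A C - Gamma c B C := by
    refine csSup_le hne1 ?_
    rintro w ⟨P, rfl⟩
    have : Gamma c B C ≤ Gamma c A C - pathWeight c P.p := by
      refine csSup_le hne2 ?_
      rintro w ⟨Q, rfl⟩
      linarith [key P Q]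
    linarith
  linarith

/-- Restart comparison: the value of the current restarted at time `t−h` and run for
time `h` does not exceed the current at time `t`: `v̄(x,h) ≤ v(x,t)`. -/
theorem stmt_12 (c : ℝ × ℝ → ℝ) (hc : SpeedFunction c)
    (v₀ : ℝ → ℝ) (hmono : Monotone v₀) (hlip : LipschitzWith 1 v₀)
    (x t h : ℝ) (hh : 0 < h) (hht : h < t)
    (hS1 : ∀ q r s : ℝ, 0 < s →
      {y : ℝ | beta r ≤ y ∧ s ≤ GammaQ c v₀ q (r + y) y}.Nonempty ∧
      IsClosed {y : ℝ | beta r ≤ y ∧ s ≤ GammaQ c v₀ q (r + y) y})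
    (hS2 : ∀ q r : ℝ,
      {y : ℝ | beta r ≤ y ∧
        h ≤ GammaW c (q, -(hydroV c v₀ q (t - h)))
          (q + r, y - hydroV c v₀ q (t - h))}.Nonempty ∧
      IsClosed {y : ℝ | beta r ≤ y ∧
        h ≤ GammaW c (q, -(hydroV c v₀ q (t - h)))
          (q + r, y - hydroV c v₀ q (t - h))})
    (hatt : ∃ qa : ℝ,
      (∀ q : ℝ, hydroV c v₀ q (t - h) - gbar c v₀ t h q (x - q) ≤
        hydroV c v₀ qa (t - h) - gbar c v₀ t h qa (x - qa)) ∧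
      ∃ q₀ : ℝ, ∀ q : ℝ,
        v₀ q - levelCurve c v₀ q (qa - q) (t - h) ≤
          v₀ q₀ - levelCurve c v₀ q₀ (qa - q₀) (t - h)) :
    vbar c v₀ t h x ≤ hydroV c v₀ x t := by
  obtain ⟨qa, hqa, q₀, hq₀⟩ := hatt
  have hV : hydroV c v₀ qa (t - h) = v₀ q₀ - levelCurve c v₀ q₀ (qa - q₀) (t - h) := by
    unfold hydroV
    exact le_antisymm (ciSup_le hq₀) (le_ciSup ⟨_, Set.forall_mem_range.2 hq₀⟩ q₀)
  have hbar : vbar c v₀ t h x ≤ hydroV c v₀ qa (t - h) - gbar c v₀ t h qa (x - qa) := by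
    unfold vbar
    exact ciSup_le hqa
  have hg : levelCurve c v₀ q₀ (qa - q₀) (t - h) ∈
      {y : ℝ | beta (qa - q₀) ≤ y ∧ t - h ≤ GammaQ c v₀ q₀ (qa - q₀ + y) y} := by
    obtain ⟨hne, hcl⟩ := hS1 q₀ (qa - q₀) (t - h) (by linarith)
    exact hcl.csInf_mem hne ⟨beta (qa - q₀), fun y hy => hy.1⟩
  have hb := (hS2 qa (x - qa)).2.csInf_mem (hS2 qa (x - qa)).1
    ⟨beta (x - qa), fun y hy => hy.1⟩
  change gbar c v₀ t h qa (x - qa) ∈ _ at hb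
  set g := levelCurve c v₀ q₀ (qa - q₀) (t - h) with hgdef
  set b := gbar c v₀ t h qa (x - qa) with hbdef
  set V := hydroV c v₀ qa (t - h) with hVdef
  obtain ⟨hg1, hg2⟩ := hg
  obtain ⟨hb1, hb2⟩ := hb
  unfold GammaQ at hg2
  unfold GammaW at hb2
  simp only at hb2
  have e1 : ((qa - q₀ + g + q₀ - v₀ q₀, g - v₀ q₀) : ℝ × ℝ) = (qa + -V, -V) := by
    ext <;> simp only <;> linarith
  rw [e1] at hg2
  have hsup := Gamma_superadd hc (lt_of_lt_of_le (by linarith) hg2) (lt_of_lt_of_le hh hb2)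
  have e2 : ((qa + (x - qa) + (b - V), b - V) : ℝ × ℝ) =
      (x - q₀ + (g + b) + q₀ - v₀ q₀, g + b - v₀ q₀) := by
    ext <;> simp only <;> linarith
  rw [e2] at hsup hb2
  have hlev : levelCurve c v₀ q₀ (x - q₀) t ≤ g + b := by
    refine csInf_le ⟨beta (x - q₀), fun y hy => hy.1⟩ ⟨?_, ?_⟩
    · unfold beta at hg1 hb1 ⊢
      have := max_le_iff.1 hg1
      have := max_le_iff.1 hb1
      refine max_le ?_ ?_ <;> linarith
    · unfold GammaQ
      linarith
  have hbd : BddAbove (Set.range fun q => v₀ q - levelCurve c v₀ q (x - q) t) := by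
    refine ⟨v₀ x, ?_⟩
    rintro _ ⟨q, rfl⟩
    have h1 : beta (x - q) ≤ levelCurve c v₀ q (x - q) t :=
      le_csInf (hS1 q (x - q) t (by linarith)).1 fun y hy => hy.1
    unfold beta at h1
    have h2 := max_le_iff.1 h1
    simp only
    rcases le_total q x with hqx | hqx
    · linarith [hmono hqx]
    · have h3 := hlip.dist_le_mul q x
      rw [Real.dist_eq, Real.dist_eq, abs_of_nonneg (sub_nonneg.2 hqx)] at h3
      have h4 := le_abs_self (v₀ q - v₀ x)
      simp only [NNReal.coe_one, one_mul] at h3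
      linarith
  have hfin : v₀ q₀ - levelCurve c v₀ q₀ (x - q₀) t ≤ hydroV c v₀ x t := le_ciSup hbd q₀
  linarith
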